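/- Every two-state Run/Reset monitor of VRASED satisfies the secure-reset LTL Specification (10). Precisely: let V be any predicate on the input-signal values (the 'violation' condition), and let the FSM have states {Run, Reset} with δ(Run, in) = Reset if V(in) holds and δ(Run, in) = Run otherwise, and δ(Reset, in) = Run if PC = 0 and δ(Reset, in) = Reset otherwise. For every input trace, the run of this FSM satisfies G: { reset → (reset U PC = 0) ∨ G(reset) }. -/

import Mathlib

/-- States of a two-state Run/Reset monitor FSM. -/
inductive S2 where
  | Run : S2
  | Reset : S2
deriving DecidableEq

-- Transition function of a two-state Run/Reset monitor: from `Run` it moves to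
-- `Reset` exactly when the violation condition `V` holds of the current inputs, and
-- from `Reset` it moves back to `Run` exactly when `PC = 0`.
open Classical in
noncomputable def twoStateDelta (V : ℕ → Prop) (PC : ℕ → ℕ) : S2 → ℕ → S2
  | S2.Run, t => if V t then S2.Reset else S2.Run
  | S2.Reset, t => if PC t = 0 then S2.Run else S2.Reset

/-- A monitor in `Reset` stays there as long as `PC` does not become `0`. -/
theorem eq_reset_of_forall_pc_ne_zero {V : ℕ → Prop} {PC : ℕ → ℕ} {s : ℕ → S2}
    (hstep : ∀ t, s (t + 1) = twoStateDelta V PC (s t) (t + 1)) {t u : ℕ}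
    (ht : s t = S2.Reset) (htu : t ≤ u) (hPC : ∀ v, t < v → v ≤ u → PC v ≠ 0) :
    s u = S2.Reset := by
  induction u, htu using Nat.le_induction with
  | base => exact ht
  | succ u htu ih =>
    rw [hstep, ih fun v hv hvu => hPC v hv (by omega)]
    simp [twoStateDelta, hPC (u + 1) (by omega) le_rfl]

/-- every two-state Run/Reset monitor of VRASED, with an arbitrary
violation predicate `V` on the input-signal values, satisfies the secure-reset LTL
Specification (10): G { reset → (reset U PC = 0) ∨ G(reset) }, where
reset(t) := (s(t) = Reset). -/
theorem two_state_monitor_satisfies_secure_reset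
    (PC Daddr DMAaddr : ℕ → ℕ)
    (irq Ren Wen DMAen : ℕ → Prop)
    (V : ℕ → ℕ → ℕ → Prop → Prop → Prop → Prop → Prop)
    (s : ℕ → S2)
    (hs0 : s 0 = S2.Reset)
    (hstep : ∀ t : ℕ, s (t + 1) =
      twoStateDelta
        (fun u => V (PC u) (Daddr u) (DMAaddr u) (irq u) (Ren u) (Wen u) (DMAen u))
        PC (s t) (t + 1)) :
    ∀ t : ℕ, s t = S2.Reset →
      ((∃ t', t ≤ t' ∧ PC t' = 0 ∧ ∀ u, t ≤ u → u < t' → s u = S2.Reset) ∨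
       (∀ u, t ≤ u → s u = S2.Reset)) := by
  intro t ht
  by_cases h : ∃ t', t ≤ t' ∧ PC t' = 0
  · classical
    refine Or.inl ⟨Nat.find h, (Nat.find_spec h).1, (Nat.find_spec h).2, fun u htu hu => ?_⟩
    exact eq_reset_of_forall_pc_ne_zero hstep ht htu fun v hv hvu hPC =>
      Nat.find_min h (hvu.trans_lt hu) ⟨hv.le, hPC⟩
  · exact Or.inr fun u htu =>
      eq_reset_of_forall_pc_ne_zero hstep ht htu fun v hv _ hPC => h ⟨v, hv.le, hPC⟩
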